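/- Let F be a generalized isotropic Berwald metric with data (μ, λ) which is of scalar flag curvature, with flag curvature function K(x,y). Then K satisfies, at every point of U × (ℝ^n ∖ {0}) and for every index k: ((n+1)/3)·∂K/∂y^k + ( K + μ²/4 − μ'/(2F) )·I_k = 0, where μ' := μ_{|s} y^s. -/

import Mathlib

/-!  Common setup: Finsler metrics on an open set `U ⊆ ℝⁿ`, in coordinates. -/

noncomputable section

open scoped BigOperators

/-- Points/vectors of `ℝⁿ`, as functions `Fin n → ℝ`. -/
abbrev Pt (n : ℕ) := Fin n → ℝ

variable {n : ℕ}

/-- Partial derivative in the fiber variable `y`, direction `yⁱ`. -/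
def pdy (f : Pt n → Pt n → ℝ) (i : Fin n) : Pt n → Pt n → ℝ :=
  fun x y => fderiv ℝ (fun y' => f x y') y (Pi.single i 1)

/-- Partial derivative in the base variable `x`, direction `xⁱ`. -/
def pdx (f : Pt n → Pt n → ℝ) (i : Fin n) : Pt n → Pt n → ℝ :=
  fun x y => fderiv ℝ (fun x' => f x' y) x (Pi.single i 1)

/-- `F²`. -/
def F2 (F : Pt n → Pt n → ℝ) : Pt n → Pt n → ℝ := fun x y => (F x y) ^ 2

/-- Fundamental tensor `g_{ij} = (1/2) ∂²(F²)/∂yⁱ∂yʲ`. -/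
def gLow (F : Pt n → Pt n → ℝ) (i j : Fin n) : Pt n → Pt n → ℝ :=
  fun x y => (1 / 2 : ℝ) * pdy (pdy (F2 F) j) i x y

/-- The fundamental tensor as a matrix. -/
def gMat (F : Pt n → Pt n → ℝ) (x y : Pt n) : Matrix (Fin n) (Fin n) ℝ :=
  Matrix.of fun i j => gLow F i j x y

/-- Inverse fundamental tensor `g^{ij}`. -/
def gInv (F : Pt n → Pt n → ℝ) (i j : Fin n) : Pt n → Pt n → ℝ :=
  fun x y => (gMat F x y)⁻¹ i j

/-- Lowered fiber variable `y_i := g_{ij} yʲ`. -/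
def yLow (F : Pt n → Pt n → ℝ) (i : Fin n) : Pt n → Pt n → ℝ :=
  fun x y => ∑ j, gLow F i j x y * y j

/-- `ℓⁱ := yⁱ / F`. -/
def ell (F : Pt n → Pt n → ℝ) (i : Fin n) : Pt n → Pt n → ℝ :=
  fun x y => y i / F x y

/-- Angular metric `h_{ij} := g_{ij} - F⁻² y_i y_j`. -/
def hLow (F : Pt n → Pt n → ℝ) (i j : Fin n) : Pt n → Pt n → ℝ :=
  fun x y => gLow F i j x y - yLow F i x y * yLow F j x y / (F x y) ^ 2

/-- `hⁱ_j := δⁱ_j - F⁻² yⁱ y_j`. -/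
def hUp (F : Pt n → Pt n → ℝ) (i j : Fin n) : Pt n → Pt n → ℝ :=
  fun x y => (if i = j then (1 : ℝ) else 0) - y i * yLow F j x y / (F x y) ^ 2

/-- Cartan torsion `C_{ijk} := (1/4) ∂³(F²)/∂yⁱ∂yʲ∂yᵏ`. -/
def Cartan (F : Pt n → Pt n → ℝ) (i j k : Fin n) : Pt n → Pt n → ℝ :=
  fun x y => (1 / 4 : ℝ) * pdy (pdy (pdy (F2 F) k) j) i x y

/-- Mean Cartan torsion `I_k := g^{ij} C_{ijk}`. -/
def mCartan (F : Pt n → Pt n → ℝ) (k : Fin n) : Pt n → Pt n → ℝ :=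
  fun x y => ∑ i, ∑ j, gInv F i j x y * Cartan F i j k x y

/-- Spray coefficients `Gⁱ`. -/
def Gspray (F : Pt n → Pt n → ℝ) (i : Fin n) : Pt n → Pt n → ℝ :=
  fun x y => (1 / 4 : ℝ) * ∑ l, gInv F i l x y *
    ((∑ k, y k * pdx (pdy (F2 F) l) k x y) - pdx (F2 F) l x y)

/-- Berwald curvature `Bⁱ_{jkl} := ∂³Gⁱ/∂yʲ∂yᵏ∂yˡ`. -/
def Bcurv (F : Pt n → Pt n → ℝ) (i j k l : Fin n) : Pt n → Pt n → ℝ :=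
  pdy (pdy (pdy (Gspray F i) l) k) j

/-- Mean Berwald curvature `E_{jk} := (1/2) Bᵐ_{jkm}`. -/
def Ecurv (F : Pt n → Pt n → ℝ) (j k : Fin n) : Pt n → Pt n → ℝ :=
  fun x y => (1 / 2 : ℝ) * ∑ m, Bcurv F m j k m x y

/-- Nonlinear connection `Nⁱ_j := ∂Gⁱ/∂yʲ`. -/
def Ncon (F : Pt n → Pt n → ℝ) (i j : Fin n) : Pt n → Pt n → ℝ :=
  pdy (Gspray F i) j

/-- Berwald connection coefficients `Γⁱ_{jk} := ∂²Gⁱ/∂yʲ∂yᵏ`. -/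
def Γcon (F : Pt n → Pt n → ℝ) (i j k : Fin n) : Pt n → Pt n → ℝ :=
  pdy (pdy (Gspray F i) k) j

/-- Horizontal (Berwald) covariant derivative of a scalar. -/
def hD0 (F : Pt n → Pt n → ℝ) (f : Pt n → Pt n → ℝ) (m : Fin n) : Pt n → Pt n → ℝ :=
  fun x y => pdx f m x y - ∑ r, Ncon F r m x y * pdy f r x y

/-- Horizontal covariant derivative of a covariant 2-tensor. -/
def hD2 (F : Pt n → Pt n → ℝ) (T : Fin n → Fin n → Pt n → Pt n → ℝ) (j k m : Fin n) :
    Pt n → Pt n → ℝ :=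
  fun x y => hD0 F (T j k) m x y - (∑ r, T r k x y * Γcon F r j m x y)
    - ∑ r, T j r x y * Γcon F r k m x y

/-- Horizontal covariant derivative of a covariant 3-tensor. -/
def hD3 (F : Pt n → Pt n → ℝ) (T : Fin n → Fin n → Fin n → Pt n → Pt n → ℝ) (i j k m : Fin n) :
    Pt n → Pt n → ℝ :=
  fun x y => hD0 F (T i j k) m x y - (∑ r, T r j k x y * Γcon F r i m x y)
    - (∑ r, T i r k x y * Γcon F r j m x y) - ∑ r, T i j r x y * Γcon F r k m x y

/-- Horizontal covariant derivative of a (1,3)-tensor `Tⁱ_{jkl}`. -/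
def hD13 (F : Pt n → Pt n → ℝ) (T : Fin n → Fin n → Fin n → Fin n → Pt n → Pt n → ℝ)
    (i j k l m : Fin n) : Pt n → Pt n → ℝ :=
  fun x y => hD0 F (T i j k l) m x y + (∑ r, T r j k l x y * Γcon F i r m x y)
    - (∑ r, T i r k l x y * Γcon F r j m x y) - (∑ r, T i j r l x y * Γcon F r k m x y)
    - ∑ r, T i j k r x y * Γcon F r l m x y

/-- Landsberg curvature `L_{ijk} := C_{ijk|m} yᵐ`. -/
def Land (F : Pt n → Pt n → ℝ) (i j k : Fin n) : Pt n → Pt n → ℝ :=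
  fun x y => ∑ m, hD3 F (Cartan F) i j k m x y * y m

/-- Stretch curvature `Σ_{ijkl} := 2(L_{ijk|l} - L_{ijl|k})`. -/
def Stretch (F : Pt n → Pt n → ℝ) (i j k l : Fin n) : Pt n → Pt n → ℝ :=
  fun x y => 2 * (hD3 F (Land F) i j k l x y - hD3 F (Land F) i j l k x y)

/-- Douglas tensor `Dⁱ_{jkl}`. -/
def Douglas (F : Pt n → Pt n → ℝ) (i j k l : Fin n) : Pt n → Pt n → ℝ :=
  fun x y => Bcurv F i j k l x y - (2 / ((n : ℝ) + 1)) *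
    (Ecurv F j k x y * (if i = l then (1 : ℝ) else 0)
      + Ecurv F j l x y * (if i = k then (1 : ℝ) else 0)
      + Ecurv F k l x y * (if i = j then (1 : ℝ) else 0)
      + pdy (Ecurv F j k) l x y * y i)

/-- Riemann curvature `Rⁱ_k`. -/
def RiemK (F : Pt n → Pt n → ℝ) (i k : Fin n) : Pt n → Pt n → ℝ :=
  fun x y => 2 * pdx (Gspray F i) k x y - (∑ j, y j * pdx (pdy (Gspray F i) k) j x y)
    + 2 * (∑ j, Gspray F j x y * Γcon F i j k x y) - ∑ j, Ncon F i j x y * Ncon F j k x y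

/-- `Rⁱ_{jkl} := (1/3) ∂/∂yʲ (∂Rⁱ_k/∂yˡ - ∂Rⁱ_l/∂yᵏ)`. -/
def Riem4 (F : Pt n → Pt n → ℝ) (i j k l : Fin n) : Pt n → Pt n → ℝ :=
  fun x y => (1 / 3 : ℝ) *
    pdy (fun x' y' => pdy (RiemK F i k) l x' y' - pdy (RiemK F i l) k x' y') j x y

/-- `F` is R-quadratic on `U`: `Rⁱ_{jkl}(x,y)` is independent of `y`. -/
def RQuadratic (U : Set (Pt n)) (F : Pt n → Pt n → ℝ) : Prop :=
  ∀ x ∈ U, ∀ y y' : Pt n, y ≠ 0 → y' ≠ 0 →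
    ∀ i j k l, Riem4 F i j k l x y = Riem4 F i j k l x y'

/-- A Finsler metric on a connected open set `U ⊆ ℝⁿ` (`n ≥ 2`). -/
structure IsFinslerMetric (U : Set (Pt n)) (F : Pt n → Pt n → ℝ) : Prop where
  dim : 2 ≤ n
  isOpen : IsOpen U
  connected : IsConnected U
  smooth : ContDiffOn ℝ (⊤ : ℕ∞) (Function.uncurry F) (U ×ˢ {y : Pt n | y ≠ 0})
  pos : ∀ x ∈ U, ∀ y : Pt n, y ≠ 0 → 0 < F x y
  homog : ∀ x ∈ U, ∀ y : Pt n, y ≠ 0 → ∀ t : ℝ, 0 < t → F x (t • y) = t * F x y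
  posdef : ∀ x ∈ U, ∀ y : Pt n, y ≠ 0 → (gMat F x y).PosDef

/-- `F` is a generalized isotropic Berwald metric on `U` with data `(μ, λ)`. -/
structure IsGIB (U : Set (Pt n)) (F μ lam : Pt n → Pt n → ℝ) : Prop where
  finsler : IsFinslerMetric U F
  smooth_mu : ContDiffOn ℝ (⊤ : ℕ∞) (Function.uncurry μ) (U ×ˢ {y : Pt n | y ≠ 0})
  smooth_lam : ContDiffOn ℝ (⊤ : ℕ∞) (Function.uncurry lam) (U ×ˢ {y : Pt n | y ≠ 0})
  homog_mu : ∀ x ∈ U, ∀ y : Pt n, y ≠ 0 → ∀ t : ℝ, 0 < t → μ x (t • y) = μ x y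
  homog_lam : ∀ x ∈ U, ∀ y : Pt n, y ≠ 0 → ∀ t : ℝ, 0 < t → lam x (t • y) = t⁻¹ * lam x y
  berwald : ∀ x ∈ U, ∀ y : Pt n, y ≠ 0 → ∀ i j k l,
    Bcurv F i j k l x y = μ x y * Cartan F j k l x y * ell F i x y
      + lam x y * (hUp F i j x y * hLow F k l x y + hUp F i k x y * hLow F j l x y
        + hUp F i l x y * hLow F j k x y)

end

/-- `F` is of scalar flag curvature with flag curvature function `K`. -/
def IsScalarFlagCurv {n : ℕ} (U : Set (Pt n)) (F K : Pt n → Pt n → ℝ) : Prop :=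
  ContDiffOn ℝ (⊤ : ℕ∞) (Function.uncurry K) (U ×ˢ {y : Pt n | y ≠ 0}) ∧
  ∀ x ∈ U, ∀ y : Pt n, y ≠ 0 → ∀ i k : Fin n,
    RiemK F i k x y = K x y * (F x y) ^ 2 * hUp F i k x y

open TopologicalSpace

/-- The derivation `∑ aᵐ Yₘ`. -/
def contr {A ι : Type*} [CommRing A] [Algebra ℝ A] [Fintype ι]
    (Y : ι → Derivation ℝ A A) (a : ι → A) : Derivation ℝ A A :=
  ∑ m, a m • Y m

lemma contr_apply {A ι : Type*} [CommRing A] [Algebra ℝ A] [Fintype ι]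
    (Y : ι → Derivation ℝ A A) (a : ι → A) (f : A) :
    contr Y a f = ∑ m, a m * Y m f := by
  have h : (contr Y a : A → A) = ∑ m, ⇑(a m • Y m) :=
    map_sum (Derivation.coeFnAddMonoidHom (R := ℝ) (A := A) (M := A)) _ _
  simp [h, Finset.sum_apply]

lemma derivation_two_mul {A : Type*} [CommRing A] [Algebra ℝ A] (D : Derivation ℝ A A) (a : A) :
    D (2 * a) = 2 * D a := by
  rw [two_mul, map_add, two_mul]

lemma derivation_contr {A ι : Type*} [CommRing A] [Algebra ℝ A] [Fintype ι]
    (Y : ι → Derivation ℝ A A) (D : Derivation ℝ A A)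
    (hD : ∀ m f, D (Y m f) = Y m (D f)) (a : ι → A) (f : A) :
    D (contr Y a f) = contr Y a (D f) + contr Y (fun m => D (a m)) f := by
  simp only [contr_apply, map_sum, Derivation.leibniz, smul_eq_mul, Finset.sum_add_distrib, hD]
  simp only [mul_comm]

lemma eq_zero_of_two_mul {A : Type*} [CommRing A] [Algebra ℝ A] {a : A} (h : 2 * a = 0) :
    a = 0 := by
  have h2 : (2 : ℝ) • a = 0 := by rw [ofNat_smul_eq_nsmul, nsmul_eq_mul]; exact_mod_cast h
  simpa using h2

/-- A commutative algebra with commuting horizontal and vertical derivations `X`, `Y`, fibre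
coordinates `y`, an energy `E` that is homogeneous of degree two, and the components `G` of its
geodesic spray. -/
structure SprayAlgebra (A ι : Type*) [CommRing A] [Algebra ℝ A] [Fintype ι] [DecidableEq ι] where
  X : ι → Derivation ℝ A A
  Y : ι → Derivation ℝ A A
  y : ι → A
  E : A
  G : ι → A
  Y_Y : ∀ i j f, Y i (Y j f) = Y j (Y i f)
  Y_X : ∀ i j f, Y i (X j f) = X j (Y i f)
  X_y : ∀ i j, X i (y j) = 0
  Y_y : ∀ i j, Y i (y j) = if i = j then 1 else 0
  euler : ∑ k, y k * Y k E = 2 * E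
  spray : ∀ l, ∑ k, y k * X k (Y l E) - 2 * ∑ m, G m * Y m (Y l E) = X l E

namespace SprayAlgebra

variable {A ι : Type*} [CommRing A] [Algebra ℝ A] [Fintype ι] [DecidableEq ι]
  (s : SprayAlgebra A ι)

/-- The spray as a derivation. -/
noncomputable def S : Derivation ℝ A A := contr s.X s.y - (2 : A) • contr s.Y s.G

/-- The derivation `Nᵐₖ ∂/∂yᵐ`. -/
noncomputable def V (k : ι) : Derivation ℝ A A := contr s.Y fun m => s.Y k (s.G m)

/-- The derivation `Γᵐₖₗ ∂/∂yᵐ`. -/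
noncomputable def W (k l : ι) : Derivation ℝ A A := contr s.Y fun m => s.Y l (s.Y k (s.G m))

/-- The derivation `Bᵐₖₗⱼ ∂/∂yᵐ`. -/
noncomputable def Z (k l j : ι) : Derivation ℝ A A :=
  contr s.Y fun m => s.Y j (s.Y l (s.Y k (s.G m)))

lemma S_apply (f : A) : s.S f = ∑ k, s.y k * s.X k f - 2 * ∑ m, s.G m * s.Y m f := by
  simp [S, contr_apply]

lemma W_symm (k l : ι) : s.W k l = s.W l k := by
  simp only [W, s.Y_Y k l]

lemma contr_y (l : ι) (f : A) : contr s.X (fun m => s.Y l (s.y m)) f = s.X l f := by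
  simp [contr_apply, s.Y_y]

lemma Y_S (l : ι) (f : A) : s.Y l (s.S f) = s.S (s.Y l f) + s.X l f - 2 * s.V l f := by
  have h1 := derivation_contr s.X (s.Y l) (fun m f => s.Y_X l m f) s.y f
  have h2 := derivation_contr s.Y (s.Y l) (fun m f => s.Y_Y l m f) s.G f
  rw [contr_y] at h1
  simp only [S, V, Derivation.sub_apply, Derivation.smul_apply, smul_eq_mul, map_sub,
    derivation_two_mul, h1, h2]
  ring

lemma Y_V (l k : ι) (f : A) : s.Y l (s.V k f) = s.V k (s.Y l f) + s.W k l f :=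
  derivation_contr s.Y (s.Y l) (fun m f => s.Y_Y l m f) _ f

lemma Y_W (j k l : ι) (f : A) : s.Y j (s.W k l f) = s.W k l (s.Y j f) + s.Z k l j f :=
  derivation_contr s.Y (s.Y j) (fun m f => s.Y_Y j m f) _ f

lemma S_Y_E (l : ι) : s.S (s.Y l s.E) = s.X l s.E := by
  rw [S_apply, s.spray]

lemma y_mul_Y_Y_E (l : ι) : ∑ k, s.y k * s.Y k (s.Y l s.E) = s.Y l s.E := by
  have h := congrArg (s.Y l) s.euler
  simp only [map_sum, derivation_two_mul] at h
  simp only [Derivation.leibniz, smul_eq_mul, Finset.sum_add_distrib, s.Y_y,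
    mul_ite, mul_one, mul_zero, Finset.sum_ite_eq, Finset.mem_univ, if_true, s.Y_Y l] at h
  linear_combination h

lemma y_mul_Y_Y_Y_E (l j : ι) : ∑ k, s.y k * s.Y k (s.Y j (s.Y l s.E)) = 0 := by
  have h := congrArg (s.Y j) (s.y_mul_Y_Y_E l)
  simp only [map_sum, Derivation.leibniz, smul_eq_mul, Finset.sum_add_distrib, s.Y_y,
    mul_ite, mul_one, mul_zero, Finset.sum_ite_eq, Finset.mem_univ, if_true, s.Y_Y j] at h
  simp only [s.Y_Y j]
  linear_combination h

lemma S_E : s.S s.E = 0 := by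
  have h : ∑ l, s.y l * s.S (s.Y l s.E) = ∑ l, s.y l * s.X l s.E := by simp only [S_Y_E]
  have hX : ∀ k, ∑ l, s.y l * s.X k (s.Y l s.E) = 2 * s.X k s.E := by
    intro k
    have h := congrArg (s.X k) s.euler
    simp only [map_sum, derivation_two_mul] at h
    simpa only [Derivation.leibniz, smul_eq_mul, s.X_y, mul_zero, add_zero, s.Y_X] using h
  have h1 : ∑ l, s.y l * ∑ k, s.y k * s.X k (s.Y l s.E)
      = ∑ k, s.y k * (2 * s.X k s.E) := by
    simp only [← hX, Finset.mul_sum]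
    rw [Finset.sum_comm]
    exact Finset.sum_congr rfl fun _ _ => Finset.sum_congr rfl fun _ _ => by ring
  have h2 : ∑ l, s.y l * ∑ m, s.G m * s.Y m (s.Y l s.E) = ∑ m, s.G m * s.Y m s.E := by
    have hm : ∀ m, s.G m * s.Y m s.E = ∑ l, s.y l * (s.G m * s.Y m (s.Y l s.E)) := by
      intro m
      rw [← s.y_mul_Y_Y_E, Finset.mul_sum]
      exact Finset.sum_congr rfl fun l _ => by rw [s.Y_Y m l]; ring
    rw [Finset.sum_congr rfl fun m _ => hm m, Finset.sum_comm]
    simp only [Finset.mul_sum]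
  have h3 : ∑ l, s.y l * s.S (s.Y l s.E) = ∑ l, s.y l * ∑ k, s.y k * s.X k (s.Y l s.E)
      - 2 * ∑ l, s.y l * ∑ m, s.G m * s.Y m (s.Y l s.E) := by
    simp only [S_apply, mul_sub, Finset.sum_sub_distrib]
    simp only [Finset.mul_sum]
    congr 1
    exact Finset.sum_congr rfl fun m _ => Finset.sum_congr rfl fun l _ => by ring
  have h4 : ∑ k, s.y k * (2 * s.X k s.E) = 2 * ∑ k, s.y k * s.X k s.E := by
    rw [Finset.mul_sum]; exact Finset.sum_congr rfl fun _ _ => by ring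
  rw [S_apply]
  linear_combination -h3 + h - h1 - h4 + 2 * h2

lemma X_E (k : ι) : s.X k s.E = s.V k s.E := by
  have h := s.Y_S k s.E
  rw [S_E, map_zero, S_Y_E] at h
  refine sub_eq_zero.mp (eq_zero_of_two_mul ?_)
  linear_combination -h

lemma X_Y_E (k l : ι) : s.X k (s.Y l s.E) = s.V k (s.Y l s.E) + s.W k l s.E := by
  rw [← s.Y_X, X_E, Y_V]

lemma X_Y_Y_E (k l j : ι) : s.X k (s.Y j (s.Y l s.E)) =
    s.V k (s.Y j (s.Y l s.E)) + s.W k j (s.Y l s.E) + s.W k l (s.Y j s.E) + s.Z k l j s.E := by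
  rw [← s.Y_X, X_Y_E, map_add, Y_V, Y_W]
  ring

lemma S_Y_Y_E (j l : ι) :
    s.S (s.Y j (s.Y l s.E)) = s.V j (s.Y l s.E) + s.V l (s.Y j s.E) := by
  have h := s.Y_S j (s.Y l s.E)
  rw [S_Y_E, s.Y_X, X_Y_E, X_Y_E, s.W_symm l j] at h
  linear_combination -h

/-- The Landsberg curvature identity `C_{ljk|m} yᵐ = -½ yₘ Bᵐ_{ljk}`. -/
lemma S_Y_Y_Y_E (k j l : ι) : s.S (s.Y k (s.Y j (s.Y l s.E))) =
    s.V k (s.Y j (s.Y l s.E)) + s.V j (s.Y k (s.Y l s.E)) + s.V l (s.Y k (s.Y j s.E))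
      - s.Z k l j s.E := by
  have h := s.Y_S k (s.Y j (s.Y l s.E))
  rw [S_Y_Y_E, map_add, Y_V, Y_V, X_Y_Y_E, s.W_symm j k, s.W_symm l k] at h
  linear_combination -h

/-- The Riemann curvature `Rⁱₖ`. -/
noncomputable def R (i k : ι) : A := 2 * s.X k (s.G i) - s.S (s.Y k (s.G i)) - s.V k (s.G i)

lemma Z_perm (k l j : ι) : s.Z k l j = s.Z l k j ∧ s.Z k l j = s.Z k j l := by
  constructor
  · simp only [Z, s.Y_Y k l]
  · simp only [Z, s.Y_Y j l]

lemma Y_Y_R (i j l k : ι) : s.Y j (s.Y l (s.R i k)) =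
    2 * s.X k (s.Y j (s.Y l (s.G i))) - s.S (s.Y j (s.Y k (s.Y l (s.G i))))
    - s.X j (s.Y k (s.Y l (s.G i))) + 2 * s.V j (s.Y k (s.Y l (s.G i)))
    - s.X l (s.Y j (s.Y k (s.G i))) + 2 * s.V l (s.Y j (s.Y k (s.G i)))
    + 2 * s.W l j (s.Y k (s.G i))
    - s.V k (s.Y j (s.Y l (s.G i))) - s.W k j (s.Y l (s.G i)) - s.W k l (s.Y j (s.G i))
    - s.Z k l j (s.G i) := by
  simp only [R, map_sub, map_add, derivation_two_mul, s.Y_X, Y_S, Y_V, Y_W]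
  rw [s.Y_Y l k]
  ring

lemma cyclic_Y_Y_R (i j k l : ι) :
    s.Y j (s.Y l (s.R i k)) + s.Y k (s.Y j (s.R i l)) + s.Y l (s.Y k (s.R i j)) =
    -3 * (s.S (s.Y k (s.Y j (s.Y l (s.G i)))) - s.V k (s.Y j (s.Y l (s.G i)))
      - s.V j (s.Y k (s.Y l (s.G i))) - s.V l (s.Y k (s.Y j (s.G i))) + s.Z k l j (s.G i)) := by
  rw [Y_Y_R, Y_Y_R, Y_Y_R, (s.Z_perm l j k).2, (s.Z_perm l k j).1, (s.Z_perm j k l).1,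
    (s.Z_perm k j l).2, s.Y_Y j k, s.Y_Y k l, s.Y_Y j l (s.G i), s.Y_Y j k (s.G i),
    s.W_symm j k, s.W_symm l k, s.W_symm l j, s.Y_Y l k (s.Y j (s.G i)), s.Y_Y l j (s.G i)]
  ring

lemma Z_apply (k j l : ι) (f : A) :
    s.Z k l j f = ∑ m, s.Y k (s.Y j (s.Y l (s.G m))) * s.Y m f := by
  rw [(s.Z_perm k l j).1, (s.Z_perm l k j).2, (s.Z_perm l j k).1, (s.Z_perm j l k).1, Z,
    contr_apply]

lemma S_Z_E (k j l : ι) : s.S (s.Z k l j s.E) =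
    ∑ i, s.Y i s.E * (s.S (s.Y k (s.Y j (s.Y l (s.G i)))) + s.Z k l j (s.G i)) := by
  have h : ∑ m, s.Y k (s.Y j (s.Y l (s.G m))) * s.V m s.E
      = ∑ i, s.Y i s.E * s.Z k l j (s.G i) := by
    simp only [Z_apply, V, contr_apply, Finset.mul_sum]
    rw [Finset.sum_comm]
    exact Finset.sum_congr rfl fun _ _ => Finset.sum_congr rfl fun _ _ => by ring
  simp only [mul_add, Finset.sum_add_distrib, ← h]
  simp only [Z_apply, map_sum, Derivation.leibniz, smul_eq_mul, S_Y_E, X_E,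
    Finset.sum_add_distrib]
  ring

/-- The spray coefficients of a nondegenerate energy are homogeneous of degree two. -/
lemma euler_G (hE : ∀ v : ι → A, (∀ l, ∑ m, v m * s.Y m (s.Y l s.E) = 0) → ∀ m, v m = 0)
    (i : ι) : ∑ k, s.y k * s.Y k (s.G i) = 2 * s.G i := by
  have hC : ∀ f, contr s.Y s.y f = ∑ k, s.y k * s.Y k f := contr_apply s.Y s.y
  have hCy : ∀ k, contr s.Y s.y (s.y k) = s.y k := by
    intro k
    simp [hC, s.Y_y]
  have hCX : ∀ k f, contr s.Y s.y (s.X k f) = s.X k (contr s.Y s.y f) := by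
    intro k f
    simp only [hC, map_sum, Derivation.leibniz, smul_eq_mul, s.X_y, s.Y_X, mul_zero, add_zero]
  have hYE : ∀ l, contr s.Y s.y (s.Y l s.E) = s.Y l s.E := fun l => by
    rw [hC, y_mul_Y_Y_E]
  have hE2 : contr s.Y s.y s.E = 2 * s.E := by rw [hC, s.euler]
  suffices h : ∀ l, ∑ m, (contr s.Y s.y (s.G m) - 2 * s.G m) * s.Y m (s.Y l s.E) = 0 by
    rw [← hC]
    exact sub_eq_zero.mp (hE _ h i)
  intro l
  have h := congrArg (contr s.Y s.y) (s.spray l)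
  have hYY : ∀ m, contr s.Y s.y (s.Y m (s.Y l s.E)) = 0 := fun m => by
    rw [hC, y_mul_Y_Y_Y_E]
  simp only [map_sub, map_sum, derivation_two_mul, hCX, hE2] at h
  simp only [Derivation.leibniz, smul_eq_mul, hCy, hCX, hYE, hYY, Finset.sum_add_distrib,
    mul_zero, zero_add] at h
  have h1 : ∑ k, s.X k (s.Y l s.E) * s.y k = ∑ k, s.y k * s.X k (s.Y l s.E) :=
    Finset.sum_congr rfl fun _ _ => mul_comm _ _
  have h2 : ∑ m, s.Y m (s.Y l s.E) * contr s.Y s.y (s.G m)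
      = ∑ m, contr s.Y s.y (s.G m) * s.Y m (s.Y l s.E) :=
    Finset.sum_congr rfl fun _ _ => mul_comm _ _
  have h3 : ∑ m, (contr s.Y s.y (s.G m) - 2 * s.G m) * s.Y m (s.Y l s.E) =
      ∑ m, contr s.Y s.y (s.G m) * s.Y m (s.Y l s.E)
        - 2 * ∑ m, s.G m * s.Y m (s.Y l s.E) := by
    rw [Finset.mul_sum, ← Finset.sum_sub_distrib]
    exact Finset.sum_congr rfl fun _ _ => by ring
  refine eq_zero_of_two_mul ?_
  rw [h1, h2] at h
  linear_combination 2 * h3 + 2 * s.spray l - h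

variable {s}

lemma two_mul_sum_V {m : A}
    (hB : ∀ j k l, 2 * s.Z j l k s.E = m * s.Y j (s.Y k (s.Y l s.E))) (k j l : ι) :
    2 * ∑ i, s.Y i s.E * s.V k (s.Y j (s.Y l (s.G i))) = m * s.V k (s.Y j (s.Y l s.E)) := by
  have h : ∑ i, s.Y i s.E * s.V k (s.Y j (s.Y l (s.G i)))
      = ∑ r, s.Y k (s.G r) * s.Z r l j s.E := by
    simp only [Z_apply, V, contr_apply, Finset.mul_sum]
    rw [Finset.sum_comm]
    exact Finset.sum_congr rfl fun _ _ => Finset.sum_congr rfl fun _ _ => by ring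
  rw [h, V, contr_apply, Finset.mul_sum, Finset.mul_sum]
  exact Finset.sum_congr rfl fun r _ => by linear_combination s.Y k (s.G r) * hB r j l

/-- The contraction of `∂²R` with `yᵢ` when the Landsberg curvature is proportional to the
Cartan torsion. -/
lemma four_mul_sum_cyclic {m : A}
    (hB : ∀ j k l, 2 * s.Z j l k s.E = m * s.Y j (s.Y k (s.Y l s.E))) (k j l : ι) :
    4 * ∑ i, s.Y i s.E *
      (s.Y j (s.Y l (s.R i k)) + s.Y k (s.Y j (s.R i l)) + s.Y l (s.Y k (s.R i j))) =
    -3 * ((2 * s.S m - m * m) * s.Y k (s.Y j (s.Y l s.E))) := by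
  have h1 : ∑ i, s.Y i s.E *
      (s.Y j (s.Y l (s.R i k)) + s.Y k (s.Y j (s.R i l)) + s.Y l (s.Y k (s.R i j))) =
      -3 * (s.S (s.Z k l j s.E) - ∑ i, s.Y i s.E * s.V k (s.Y j (s.Y l (s.G i)))
        - ∑ i, s.Y i s.E * s.V j (s.Y k (s.Y l (s.G i)))
        - ∑ i, s.Y i s.E * s.V l (s.Y k (s.Y j (s.G i)))) := by
    rw [S_Z_E]
    simp only [← Finset.sum_sub_distrib, Finset.mul_sum, cyclic_Y_Y_R]
    exact Finset.sum_congr rfl fun _ _ => by ring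
  have h2 := congrArg s.S (hB k j l)
  rw [derivation_two_mul, Derivation.leibniz, smul_eq_mul, smul_eq_mul, S_Y_Y_Y_E] at h2
  linear_combination 4 * h1 - 6 * h2 + 6 * two_mul_sum_V hB k j l + 6 * two_mul_sum_V hB j k l
    + 6 * two_mul_sum_V hB l k j + 3 * m * hB k j l

lemma two_mul_Y_Y_R {K : A}
    (hR : ∀ i k, 2 * s.R i k = K * (2 * s.E * (if i = k then 1 else 0) - s.y i * s.Y k s.E))
    (i j l k : ι) : 2 * s.Y j (s.Y l (s.R i k)) =
      2 * s.Y j (s.Y l (K * s.E)) * (if i = k then 1 else 0)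
      - s.Y j (s.Y l (K * s.Y k s.E)) * s.y i
      - s.Y l (K * s.Y k s.E) * (if i = j then 1 else 0)
      - s.Y j (K * s.Y k s.E) * (if i = l then 1 else 0) := by
  have hδ : ∀ (D : Derivation ℝ A A) (a : A) (P : Prop) [Decidable P],
      D (a * if P then 1 else 0) = D a * if P then 1 else 0 := by
    intro D a P _
    split_ifs <;> simp
  have h : 2 * s.R i k = 2 * (K * s.E * if i = k then 1 else 0) - K * s.Y k s.E * s.y i := by
    rw [hR]; ring
  have hy : ∀ (a : A) (l : ι), s.Y l (a * s.y i) =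
      s.Y l a * s.y i + a * (if i = l then 1 else 0) := by
    intro a l
    simp only [Derivation.leibniz, smul_eq_mul, s.Y_y, eq_comm (a := i)]
    ring
  rw [← derivation_two_mul, ← derivation_two_mul, h]
  simp only [map_sub, map_add, derivation_two_mul, hδ, hy]
  ring

lemma two_mul_sum_Y_Y_R {K : A}
    (hR : ∀ i k, 2 * s.R i k = K * (2 * s.E * (if i = k then 1 else 0) - s.y i * s.Y k s.E))
    (j l k : ι) : 2 * ∑ i, s.Y i s.E * s.Y j (s.Y l (s.R i k)) =
      2 * s.Y j (s.Y l (K * s.E)) * s.Y k s.E - 2 * s.E * s.Y j (s.Y l (K * s.Y k s.E))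
      - s.Y l (K * s.Y k s.E) * s.Y j s.E - s.Y j (K * s.Y k s.E) * s.Y l s.E := by
  have h : 2 * ∑ i, s.Y i s.E * s.Y j (s.Y l (s.R i k)) =
      ∑ i, s.Y i s.E * (2 * s.Y j (s.Y l (s.R i k))) := by
    rw [Finset.mul_sum]; exact Finset.sum_congr rfl fun _ _ => by ring
  have hδ : ∀ (a : A) (k : ι), ∑ i, s.Y i s.E * (a * if i = k then 1 else 0) = a * s.Y k s.E := by
    intro a k
    simp [mul_comm]
  have hy : ∀ a : A, ∑ i, s.Y i s.E * (a * s.y i) = a * (2 * s.E) := by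
    intro a
    rw [← s.euler, Finset.mul_sum]
    exact Finset.sum_congr rfl fun _ _ => by ring
  rw [h]
  simp only [two_mul_Y_Y_R hR, mul_sub, Finset.sum_sub_distrib, hδ, hy]
  ring

/-- The polynomial form of the scalar flag curvature identity. -/
theorem scalar_flag_identity {m K : A}
    (hB : ∀ j k l, 2 * s.Z j l k s.E = m * s.Y j (s.Y k (s.Y l s.E)))
    (hR : ∀ i k, 2 * s.R i k = K * (2 * s.E * (if i = k then 1 else 0) - s.y i * s.Y k s.E))
    (j k l : ι) :
    4 * (s.Y j K * s.Y k s.E * s.Y l s.E + s.Y k K * s.Y j s.E * s.Y l s.E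
        + s.Y l K * s.Y j s.E * s.Y k s.E)
      - 8 * s.E * (s.Y j K * s.Y k (s.Y l s.E) + s.Y k K * s.Y j (s.Y l s.E)
        + s.Y l K * s.Y j (s.Y k s.E))
      - 12 * s.E * K * s.Y j (s.Y k (s.Y l s.E)) =
    -3 * ((2 * s.S m - m * m) * s.Y j (s.Y k (s.Y l s.E))) := by
  have h := four_mul_sum_cyclic hB j k l
  simp only [mul_add, Finset.sum_add_distrib] at h
  have h1 := two_mul_sum_Y_Y_R hR k l j
  have h2 := two_mul_sum_Y_Y_R hR j k l
  have h3 := two_mul_sum_Y_Y_R hR l j k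
  simp only [Derivation.leibniz, smul_eq_mul, map_add, s.Y_Y l j, s.Y_Y l k, s.Y_Y k j]
    at h h1 h2 h3
  linear_combination h - 2 * h1 - 2 * h2 - 2 * h3

end SprayAlgebra

/-- The algebra of smooth real functions on an open subset of a normed space. -/
def smoothAlgebra {V : Type*} [NormedAddCommGroup V] [NormedSpace ℝ V] (Ω : Opens V) :
    Subalgebra ℝ (Ω → ℝ) where
  carrier := {f | ∃ g : V → ℝ, ContDiffOn ℝ (⊤ : ℕ∞) g Ω ∧ ∀ p : Ω, f p = g p}
  mul_mem' := by
    rintro a b ⟨f, hf, hfa⟩ ⟨g, hg, hgb⟩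
    exact ⟨fun p => f p * g p, hf.mul hg, fun p => by simp [hfa, hgb]⟩
  add_mem' := by
    rintro a b ⟨f, hf, hfa⟩ ⟨g, hg, hgb⟩
    exact ⟨fun p => f p + g p, hf.add hg, fun p => by simp [hfa, hgb]⟩
  algebraMap_mem' r := ⟨fun _ => r, contDiffOn_const, fun _ => rfl⟩

namespace smoothAlgebra

variable {V : Type*} [NormedAddCommGroup V] [NormedSpace ℝ V] {Ω : Opens V}

/-- Evaluation at a point. -/
def evalAt (p : Ω) : smoothAlgebra Ω →ₐ[ℝ] ℝ :=
  (Pi.evalAlgHom ℝ (fun _ : Ω => ℝ) p).comp (smoothAlgebra Ω).val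

/-- The restriction of a smooth function. -/
def ofContDiffOn (g : V → ℝ) (hg : ContDiffOn ℝ (⊤ : ℕ∞) g Ω) : smoothAlgebra Ω :=
  ⟨fun p => g p, g, hg, fun _ => rfl⟩

@[simp]
lemma evalAt_ofContDiffOn (g : V → ℝ) (hg : ContDiffOn ℝ (⊤ : ℕ∞) g Ω) (p : Ω) :
    evalAt p (ofContDiffOn g hg) = g p := rfl

lemma ext_evalAt {a b : smoothAlgebra Ω} (h : ∀ p, evalAt p a = evalAt p b) : a = b :=
  Subtype.ext (funext h)

/-- A function on the ambient space extending an element of the algebra. -/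
noncomputable def extension (a : smoothAlgebra Ω) : V → ℝ := a.2.choose

lemma contDiffOn_extension (a : smoothAlgebra Ω) : ContDiffOn ℝ (⊤ : ℕ∞) (extension a) Ω :=
  a.2.choose_spec.1

lemma extension_apply (a : smoothAlgebra Ω) (p : Ω) : extension a p = evalAt p a :=
  (a.2.choose_spec.2 p).symm

lemma contDiffAt_extension (a : smoothAlgebra Ω) (p : Ω) :
    ContDiffAt ℝ (⊤ : ℕ∞) (extension a) p :=
  (contDiffOn_extension a).contDiffAt (Ω.isOpen.mem_nhds p.2)

lemma differentiableAt_extension (a : smoothAlgebra Ω) (p : Ω) :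
    DifferentiableAt ℝ (extension a) p :=
  (contDiffAt_extension a p).differentiableAt (by simp)

lemma fderiv_extension {a : smoothAlgebra Ω} {g : V → ℝ} (h : ∀ p : Ω, g p = evalAt p a)
    (p : Ω) : fderiv ℝ (extension a) p = fderiv ℝ g p := by
  refine Filter.EventuallyEq.fderiv_eq ?_
  filter_upwards [Ω.isOpen.mem_nhds p.2] with q hq
  exact (extension_apply a ⟨q, hq⟩).trans (h ⟨q, hq⟩).symm

lemma contDiffOn_fderiv_apply {g : V → ℝ} (hg : ContDiffOn ℝ (⊤ : ℕ∞) g Ω) (v : V) :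
    ContDiffOn ℝ (⊤ : ℕ∞) (fun q => fderiv ℝ g q v) Ω :=
  (hg.fderiv_of_isOpen Ω.isOpen (by simp)).clm_apply contDiffOn_const

/-- The directional derivative. -/
noncomputable def dirDeriv (v : V) : Derivation ℝ (smoothAlgebra Ω) (smoothAlgebra Ω) :=
  Derivation.mk'
    { toFun := fun a => ofContDiffOn (fun q => fderiv ℝ (extension a) q v)
        (contDiffOn_fderiv_apply (contDiffOn_extension a) v)
      map_add' := fun a b => ext_evalAt fun p => by
        rw [map_add, evalAt_ofContDiffOn, evalAt_ofContDiffOn, evalAt_ofContDiffOn,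
          fderiv_extension (g := extension a + extension b) (fun q => by
            simp [extension_apply]),
          fderiv_add (differentiableAt_extension a p) (differentiableAt_extension b p)]
        rfl
      map_smul' := fun r a => ext_evalAt fun p => by
        rw [map_smul, evalAt_ofContDiffOn, evalAt_ofContDiffOn,
          fderiv_extension (g := r • extension a) (fun q => by simp [extension_apply]),
          fderiv_const_smul (differentiableAt_extension a p)]
        rfl }
    fun a b => ext_evalAt fun p => by
      simp only [LinearMap.coe_mk, AddHom.coe_mk, map_add, smul_eq_mul, map_mul,
        evalAt_ofContDiffOn]
      rw [fderiv_extension (g := extension a * extension b) (fun q => by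
            simp [extension_apply]),
          fderiv_mul (differentiableAt_extension a p) (differentiableAt_extension b p)]
      simp [extension_apply]

lemma evalAt_dirDeriv {a : smoothAlgebra Ω} {g : V → ℝ} (h : ∀ p : Ω, g p = evalAt p a)
    (v : V) (p : Ω) : evalAt p (dirDeriv v a) = fderiv ℝ g p v := by
  rw [← fderiv_extension h]
  rfl

lemma dirDeriv_comm (v w : V) (a : smoothAlgebra Ω) :
    dirDeriv v (dirDeriv w a) = dirDeriv w (dirDeriv v a) := by
  have h : ∀ (v w : V) (p : Ω), evalAt p (dirDeriv v (dirDeriv w a)) =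
      fderiv ℝ (fderiv ℝ (extension a)) p v w := by
    intro v w p
    rw [evalAt_dirDeriv (a := dirDeriv w a) (g := fun q => fderiv ℝ (extension a) q w)
      (fun q => rfl)]
    rw [fderiv_clm_apply (((contDiffAt_extension a p).fderiv_right (m := 1) (by
      norm_cast)).differentiableAt (by simp)) (by fun_prop)]
    simp
  refine ext_evalAt fun p => ?_
  rw [h, h]
  exact ((contDiffAt_extension a p).isSymmSndFDerivAt (by simp; norm_cast)) v w

lemma isUnit_of_evalAt_ne_zero {a : smoothAlgebra Ω} (h : ∀ p, evalAt p a ≠ 0) : IsUnit a := by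
  refine .of_mul_eq_one (ofContDiffOn (fun q => (extension a q)⁻¹)
    ((contDiffOn_extension a).inv fun q hq => ?_)) (ext_evalAt fun p => ?_)
  · rw [extension_apply a ⟨q, hq⟩]
    exact h _
  · simp [extension_apply, h p]

end smoothAlgebra
section Coordinates

open smoothAlgebra

variable {n : ℕ} {Ω : Opens (Pt n × Pt n)}

/-- `f` restricts to the element `a` of the algebra of smooth functions on `Ω`. -/
def Represents (f : Pt n → Pt n → ℝ) (a : smoothAlgebra Ω) : Prop :=
  ∀ p : Ω, f p.1.1 p.1.2 = evalAt p a

/-- The derivation `∂/∂xⁱ`. -/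
noncomputable def derivX (i : Fin n) : Derivation ℝ (smoothAlgebra Ω) (smoothAlgebra Ω) :=
  dirDeriv (Pi.single i 1, 0)

/-- The derivation `∂/∂yⁱ`. -/
noncomputable def derivY (i : Fin n) : Derivation ℝ (smoothAlgebra Ω) (smoothAlgebra Ω) :=
  dirDeriv (0, Pi.single i 1)

/-- The fibre coordinate `yⁱ`. -/
noncomputable def coordY (i : Fin n) : smoothAlgebra Ω :=
  ofContDiffOn (fun q => q.2 i) (by fun_prop)

lemma Represents.pdy {f : Pt n → Pt n → ℝ} {a : smoothAlgebra Ω} (h : Represents f a)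
    (i : Fin n) : Represents (pdy f i) (derivY i a) := by
  rintro ⟨⟨x, y⟩, hp⟩
  have hd := differentiableAt_extension a ⟨(x, y), hp⟩
  have he : (fun y' => f x y') =ᶠ[nhds y] fun y' => extension a (x, y') := by
    filter_upwards [(Continuous.prodMk_right x).continuousAt.preimage_mem_nhds
      (Ω.isOpen.mem_nhds hp)] with y' hy'
    exact (h ⟨(x, y'), hy'⟩).trans (extension_apply a ⟨(x, y'), hy'⟩).symm
  rw [derivY, evalAt_dirDeriv (extension_apply a)]
  have hc := hd.hasFDerivAt.comp y (hasFDerivAt_prodMk_right x y)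
  rw [_root_.pdy, (hc.congr_of_eventuallyEq he).fderiv]
  simp

lemma Represents.pdx {f : Pt n → Pt n → ℝ} {a : smoothAlgebra Ω} (h : Represents f a)
    (i : Fin n) : Represents (pdx f i) (derivX i a) := by
  rintro ⟨⟨x, y⟩, hp⟩
  have hd := differentiableAt_extension a ⟨(x, y), hp⟩
  have he : (fun x' => f x' y) =ᶠ[nhds x] fun x' => extension a (x', y) := by
    filter_upwards [(Continuous.prodMk_left y).continuousAt.preimage_mem_nhds
      (Ω.isOpen.mem_nhds hp)] with x' hx'
    exact (h ⟨(x', y), hx'⟩).trans (extension_apply a ⟨(x', y), hx'⟩).symm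
  rw [derivX, evalAt_dirDeriv (extension_apply a)]
  have hc := HasFDerivAt.comp (g := extension a) (f := fun x' => (x', y)) x hd.hasFDerivAt
    (hasFDerivAt_prodMk_left x y)
  rw [_root_.pdx, (hc.congr_of_eventuallyEq he).fderiv]
  simp

lemma evalAt_coordY (p : Ω) (i : Fin n) : evalAt p (coordY i) = p.1.2 i := rfl

lemma fderiv_coordY (q : Pt n × Pt n) (i : Fin n) (v : Pt n × Pt n) :
    fderiv ℝ (fun q : Pt n × Pt n => q.2 i) q v = v.2 i :=
  congrArg (· v) (((ContinuousLinearMap.proj (R := ℝ) i).comp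
    (ContinuousLinearMap.snd ℝ (Pt n) (Pt n))).fderiv (x := q))

lemma derivX_coordY (i j : Fin n) : derivX i (coordY j : smoothAlgebra Ω) = 0 :=
  ext_evalAt fun p => by
    rw [derivX, evalAt_dirDeriv (g := fun q => q.2 j) (fun _ => rfl), fderiv_coordY]
    simp

lemma derivY_coordY (i j : Fin n) :
    derivY i (coordY j : smoothAlgebra Ω) = if i = j then 1 else 0 :=
  ext_evalAt fun p => by
    rw [derivY, evalAt_dirDeriv (g := fun q => q.2 j) (fun _ => rfl), fderiv_coordY]
    rcases eq_or_ne i j with rfl | h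
    · simp
    · simp [h, h.symm]

end Coordinates

namespace IsFinslerMetric

open smoothAlgebra

variable {n : ℕ} {U : Set (Pt n)} {F : Pt n → Pt n → ℝ}

lemma euler (hF : IsFinslerMetric U F) {x y : Pt n} (hx : x ∈ U) (hy : y ≠ 0) :
    ∑ k, y k * pdy F k x y = F x y := by
  have hd : DifferentiableAt ℝ (F x) y := by
    have h1 : DifferentiableAt ℝ (Function.uncurry F) (x, y) :=
      (hF.smooth.contDiffAt ((hF.isOpen.prod isOpen_ne).mem_nhds
        (Set.mk_mem_prod hx hy))).differentiableAt (by simp)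
    exact h1.comp (f := fun y' => (x, y')) y (by fun_prop)
  have hsum : ∑ k, y k * pdy F k x y = fderiv ℝ (F x) y y := by
    conv_rhs => rw [pi_eq_sum_univ' y]
    rw [map_sum]
    refine Finset.sum_congr rfl fun k _ => ?_
    rw [map_smul, smul_eq_mul]
    congr 2
    ext j
    simp [Pi.single_apply]
  rw [hsum]
  have h1 : HasDerivAt (fun t : ℝ => F x (t • y)) (fderiv ℝ (F x) y y) 1 := by
    have hl : HasDerivAt (fun t : ℝ => t • y) y 1 := by
      simpa using (hasDerivAt_id (1 : ℝ)).smul_const y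
    refine HasFDerivAt.comp_hasDerivAt (1 : ℝ) (l := F x) ?_ hl
    rw [one_smul]
    exact hd.hasFDerivAt
  have h2 : HasDerivAt (fun t : ℝ => F x (t • y)) (F x y) 1 := by
    have h3 : HasDerivAt (fun t : ℝ => t * F x y) (F x y) 1 := by
      simpa using (hasDerivAt_id (1 : ℝ)).mul_const (F x y)
    refine h3.congr_of_eventuallyEq ?_
    filter_upwards [lt_mem_nhds (zero_lt_one' ℝ)] with t ht
    exact hF.homog x hx y hy t ht
  exact h1.unique h2

/-- The slit tangent bundle over `U`. -/
def slit (hF : IsFinslerMetric U F) : Opens (Pt n × Pt n) :=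
  ⟨U ×ˢ {y : Pt n | y ≠ 0}, hF.isOpen.prod isOpen_ne⟩

/-- `F` as an element of the algebra of smooth functions. -/
noncomputable def norm (hF : IsFinslerMetric U F) : smoothAlgebra hF.slit :=
  ofContDiffOn (Function.uncurry F) hF.smooth

lemma represents_norm (hF : IsFinslerMetric U F) : Represents F hF.norm := fun _ => rfl

lemma represents_norm_sq (hF : IsFinslerMetric U F) : Represents (F2 F) (hF.norm ^ 2) :=
  fun p => by rw [map_pow]; rfl

/-- The fundamental tensor with entries in the algebra of smooth functions. -/
noncomputable def metric (hF : IsFinslerMetric U F) :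
    Matrix (Fin n) (Fin n) (smoothAlgebra hF.slit) :=
  .of fun i j => (1 / 2 : ℝ) • derivY i (derivY j (hF.norm ^ 2))

lemma represents_metric (hF : IsFinslerMetric U F) (i j : Fin n) :
    Represents (gLow F i j) (hF.metric i j) := fun p => by
  rw [metric, Matrix.of_apply, map_smul, ← (hF.represents_norm_sq.pdy j).pdy i p, gLow,
    smul_eq_mul]

lemma map_metric (hF : IsFinslerMetric U F) (p : hF.slit) :
    hF.metric.map (evalAt p) = gMat F p.1.1 p.1.2 := by
  ext i j
  exact (hF.represents_metric i j p).symm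

lemma isUnit_det_metric (hF : IsFinslerMetric U F) : IsUnit hF.metric.det :=
  isUnit_of_evalAt_ne_zero fun p => by
    rw [AlgHom.map_det]
    have h : (evalAt p).mapMatrix hF.metric = gMat F p.1.1 p.1.2 := hF.map_metric p
    rw [h]
    exact (hF.posdef _ p.2.1 _ p.2.2).det_pos.ne'

lemma represents_metric_inv (hF : IsFinslerMetric U F) (i j : Fin n) :
    Represents (gInv F i j) (hF.metric⁻¹ i j) := fun p => by
  have h : hF.metric.map (evalAt p) * hF.metric⁻¹.map (evalAt p) = 1 := by
    rw [← Matrix.map_mul, Matrix.mul_nonsing_inv _ hF.isUnit_det_metric]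
    exact Matrix.map_one _ (map_zero _) (map_one _)
  rw [gInv, ← hF.map_metric p, Matrix.inv_eq_right_inv h, Matrix.map_apply]

lemma metric_symm (hF : IsFinslerMetric U F) (i j : Fin n) : hF.metric i j = hF.metric j i := by
  simp only [metric, Matrix.of_apply]
  rw [derivY, derivY, dirDeriv_comm]

/-- The spray coefficients as elements of the algebra of smooth functions. -/
noncomputable def spray (hF : IsFinslerMetric U F) (i : Fin n) : smoothAlgebra hF.slit :=
  (1 / 4 : ℝ) • ∑ l, hF.metric⁻¹ i l *
    (∑ k, coordY k * derivX k (derivY l (hF.norm ^ 2)) - derivX l (hF.norm ^ 2))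

lemma represents_spray (hF : IsFinslerMetric U F) (i : Fin n) :
    Represents (Gspray F i) (hF.spray i) := fun p => by
  simp only [spray, map_smul, map_sum, map_mul, map_sub, evalAt_coordY,
    ← hF.represents_metric_inv i _ p, ← (hF.represents_norm_sq.pdy _).pdx _ p,
    ← hF.represents_norm_sq.pdx _ p, smul_eq_mul, Gspray]

lemma sum_spray_mul (hF : IsFinslerMetric U F) (l : Fin n) :
    2 * ∑ m, hF.spray m * derivY m (derivY l (hF.norm ^ 2)) =
      ∑ k, coordY k * derivX k (derivY l (hF.norm ^ 2)) - derivX l (hF.norm ^ 2) := by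
  set w : Fin n → smoothAlgebra hF.slit := fun l =>
    ∑ k, coordY k * derivX k (derivY l (hF.norm ^ 2)) - derivX l (hF.norm ^ 2) with hw
  have h1 : ∀ m, 2 * (hF.spray m * derivY m (derivY l (hF.norm ^ 2))) =
      hF.metric l m * (hF.metric⁻¹.mulVec w) m := by
    intro m
    have h : (hF.metric⁻¹.mulVec w) m = (4 : ℝ) • hF.spray m := by
      simp [spray, Matrix.mulVec, dotProduct, smul_smul, hw]
    have h2 : derivY m (derivY l (hF.norm ^ 2)) = (2 : ℝ) • hF.metric m l := by
      simp [metric, smul_smul]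
    rw [h, h2, hF.metric_symm l m, mul_smul_comm, mul_smul_comm, mul_smul_comm,
      show (4 : ℝ) = 2 * 2 by norm_num, mul_smul]
    simp only [two_smul]
    ring
  rw [Finset.mul_sum, Finset.sum_congr rfl fun m _ => h1 m]
  change (hF.metric.mulVec (hF.metric⁻¹.mulVec w)) l = w l
  rw [Matrix.mulVec_mulVec, Matrix.mul_nonsing_inv _ hF.isUnit_det_metric, Matrix.one_mulVec]

lemma sum_coordY_mul_derivY_norm (hF : IsFinslerMetric U F) :
    ∑ k, coordY k * derivY k hF.norm = hF.norm := ext_evalAt fun p => by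
  simp only [map_sum, map_mul, evalAt_coordY, ← hF.represents_norm.pdy _ p]
  exact hF.euler p.2.1 p.2.2

/-- The spray algebra of a Finsler metric. -/
noncomputable def sprayAlgebra (hF : IsFinslerMetric U F) :
    SprayAlgebra (smoothAlgebra hF.slit) (Fin n) where
  X := derivX
  Y := derivY
  y := coordY
  E := hF.norm ^ 2
  G := hF.spray
  Y_Y _ _ _ := dirDeriv_comm _ _ _
  Y_X _ _ _ := dirDeriv_comm _ _ _
  X_y := derivX_coordY
  Y_y := derivY_coordY
  euler := by
    have h : ∀ k, coordY k * derivY k (hF.norm ^ 2) =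
        2 * hF.norm * (coordY k * derivY k hF.norm) := fun k => by
      rw [pow_two, Derivation.leibniz, smul_eq_mul]
      ring
    rw [Finset.sum_congr rfl fun k _ => h k, ← Finset.mul_sum, hF.sum_coordY_mul_derivY_norm]
    ring
  spray l := by
    rw [hF.sum_spray_mul l]
    ring

lemma sprayAlgebra_nondegenerate (hF : IsFinslerMetric U F) (v : Fin n → smoothAlgebra hF.slit)
    (hv : ∀ l, ∑ m, v m * hF.sprayAlgebra.Y m (hF.sprayAlgebra.Y l hF.sprayAlgebra.E) = 0)
    (m : Fin n) : v m = 0 := by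
  have h : hF.metric.mulVec v = 0 := by
    ext1 l
    have h2 : ∀ m, hF.metric l m * v m =
        (1 / 2 : ℝ) • (v m * hF.sprayAlgebra.Y m (hF.sprayAlgebra.Y l hF.sprayAlgebra.E)) := by
      intro m
      rw [hF.metric_symm l m, mul_comm, ← mul_smul_comm]
      rfl
    rw [Matrix.mulVec, dotProduct, Finset.sum_congr rfl fun m _ => h2 m, ← Finset.smul_sum, hv,
      smul_zero, Pi.zero_apply]
  have h2 := congrArg (hF.metric⁻¹.mulVec ·) h
  simp only [Matrix.mulVec_mulVec, Matrix.nonsing_inv_mul _ hF.isUnit_det_metric,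
    Matrix.one_mulVec, Matrix.mulVec_zero] at h2
  exact congrFun h2 m

lemma represents_Y {hF : IsFinslerMetric U F} {f : Pt n → Pt n → ℝ} {a : smoothAlgebra hF.slit}
    (h : Represents f a) (i : Fin n) : Represents (pdy f i) (hF.sprayAlgebra.Y i a) :=
  h.pdy i

lemma represents_X {hF : IsFinslerMetric U F} {f : Pt n → Pt n → ℝ} {a : smoothAlgebra hF.slit}
    (h : Represents f a) (i : Fin n) : Represents (pdx f i) (hF.sprayAlgebra.X i a) :=
  h.pdx i

lemma represents_G (hF : IsFinslerMetric U F) (i : Fin n) :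
    Represents (Gspray F i) (hF.sprayAlgebra.G i) :=
  hF.represents_spray i

lemma represents_E (hF : IsFinslerMetric U F) : Represents (F2 F) hF.sprayAlgebra.E :=
  hF.represents_norm_sq

lemma evalAt_y (hF : IsFinslerMetric U F) (p : hF.slit) (i : Fin n) :
    evalAt p (hF.sprayAlgebra.y i) = p.1.2 i := rfl

lemma gLow_symm (hF : IsFinslerMetric U F) (p : hF.slit) (i j : Fin n) :
    gLow F i j p.1.1 p.1.2 = gLow F j i p.1.1 p.1.2 := by
  rw [hF.represents_metric i j p, hF.represents_metric j i p, hF.metric_symm]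

lemma evalAt_Y_Y_E (hF : IsFinslerMetric U F) (p : hF.slit) (i j : Fin n) :
    evalAt p (hF.sprayAlgebra.Y i (hF.sprayAlgebra.Y j hF.sprayAlgebra.E)) =
      2 * gLow F i j p.1.1 p.1.2 := by
  rw [← represents_Y (represents_Y hF.represents_E j) i p, gLow]
  ring

lemma evalAt_Y_Y_Y_E (hF : IsFinslerMetric U F) (p : hF.slit) (i j k : Fin n) :
    evalAt p (hF.sprayAlgebra.Y i (hF.sprayAlgebra.Y j (hF.sprayAlgebra.Y k hF.sprayAlgebra.E))) =
      4 * Cartan F i j k p.1.1 p.1.2 := by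
  rw [← represents_Y (represents_Y (represents_Y hF.represents_E k) j) i p, Cartan]
  ring

lemma evalAt_Y_E (hF : IsFinslerMetric U F) (p : hF.slit) (i : Fin n) :
    evalAt p (hF.sprayAlgebra.Y i hF.sprayAlgebra.E) = 2 * yLow F i p.1.1 p.1.2 := by
  rw [← hF.sprayAlgebra.y_mul_Y_Y_E i, map_sum, yLow, Finset.mul_sum]
  refine Finset.sum_congr rfl fun k _ => ?_
  rw [map_mul, evalAt_Y_Y_E, evalAt_y, hF.gLow_symm p i k]
  ring

lemma sum_yLow_mul (hF : IsFinslerMetric U F) (p : hF.slit) :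
    ∑ i, yLow F i p.1.1 p.1.2 * p.1.2 i = F p.1.1 p.1.2 ^ 2 := by
  have h := congrArg (evalAt p) hF.sprayAlgebra.euler
  simp only [map_sum, map_mul, evalAt_Y_E, evalAt_y, map_ofNat] at h
  rw [← hF.represents_E p, F2] at h
  have h2 : ∑ i, p.1.2 i * (2 * yLow F i p.1.1 p.1.2) =
      2 * ∑ i, yLow F i p.1.1 p.1.2 * p.1.2 i := by
    rw [Finset.mul_sum]
    exact Finset.sum_congr rfl fun _ _ => by ring
  linarith

lemma sum_Cartan_mul (hF : IsFinslerMetric U F) (p : hF.slit) (j k : Fin n) :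
    ∑ l, Cartan F j k l p.1.1 p.1.2 * p.1.2 l = 0 := by
  have h := congrArg (evalAt p) (hF.sprayAlgebra.y_mul_Y_Y_Y_E k j)
  have hY : ∀ l, evalAt p (hF.sprayAlgebra.Y l (hF.sprayAlgebra.Y j
      (hF.sprayAlgebra.Y k hF.sprayAlgebra.E))) = 4 * Cartan F j k l p.1.1 p.1.2 := fun l => by
    rw [hF.sprayAlgebra.Y_Y l j, hF.sprayAlgebra.Y_Y l k, evalAt_Y_Y_Y_E]
  simp only [map_sum, map_mul, map_zero, evalAt_y, hY] at h
  have h2 : ∑ l, p.1.2 l * (4 * Cartan F j k l p.1.1 p.1.2) =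
      4 * ∑ l, Cartan F j k l p.1.1 p.1.2 * p.1.2 l := by
    rw [Finset.mul_sum]
    exact Finset.sum_congr rfl fun _ _ => by ring
  linarith

lemma evalAt_S (hF : IsFinslerMetric U F) (p : hF.slit) {f : Pt n → Pt n → ℝ}
    {a : smoothAlgebra hF.slit} (h : Represents f a) :
    evalAt p (hF.sprayAlgebra.S a) = ∑ k, p.1.2 k * pdx f k p.1.1 p.1.2 -
      2 * ∑ m, Gspray F m p.1.1 p.1.2 * pdy f m p.1.1 p.1.2 := by
  simp only [SprayAlgebra.S_apply, map_sub, map_sum, map_mul, map_ofNat, evalAt_y,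
    ← hF.represents_G _ p, ← represents_X h _ p, ← represents_Y h _ p]

lemma evalAt_S_eq_sum_hD0 (hF : IsFinslerMetric U F) (p : hF.slit) {f : Pt n → Pt n → ℝ}
    {a : smoothAlgebra hF.slit} (h : Represents f a) :
    evalAt p (hF.sprayAlgebra.S a) = ∑ k, hD0 F f k p.1.1 p.1.2 * p.1.2 k := by
  have hG : ∀ m, 2 * Gspray F m p.1.1 p.1.2 = ∑ k, p.1.2 k * Ncon F m k p.1.1 p.1.2 := by
    intro m
    have h := congrArg (evalAt p)
      (hF.sprayAlgebra.euler_G (fun v hv m => hF.sprayAlgebra_nondegenerate v hv m) m)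
    simp only [map_sum, map_mul, evalAt_y, ← represents_Y (hF.represents_G _) _ p,
      ← hF.represents_G _ p, map_ofNat] at h
    exact h.symm
  rw [hF.evalAt_S p h, Finset.mul_sum]
  simp only [hD0, sub_mul, Finset.sum_sub_distrib, Finset.sum_mul, ← mul_assoc, hG]
  rw [Finset.sum_comm]
  congr 1
  · exact Finset.sum_congr rfl fun _ _ => mul_comm _ _
  · exact Finset.sum_congr rfl fun _ _ => Finset.sum_congr rfl fun _ _ => by ring

lemma evalAt_R (hF : IsFinslerMetric U F) (p : hF.slit) (i k : Fin n) :
    evalAt p (hF.sprayAlgebra.R i k) = RiemK F i k p.1.1 p.1.2 := by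
  simp only [SprayAlgebra.R, SprayAlgebra.V, contr_apply, map_sub, map_sum, map_mul, map_ofNat,
    hF.evalAt_S p (represents_Y (hF.represents_G _) _), ← represents_X (hF.represents_G _) _ p,
    ← represents_Y (hF.represents_G _) _ p, RiemK, Γcon, Ncon]
  have h : ∑ m, pdy (Gspray F m) k p.1.1 p.1.2 * pdy (Gspray F i) m p.1.1 p.1.2 =
      ∑ m, pdy (Gspray F i) m p.1.1 p.1.2 * pdy (Gspray F m) k p.1.1 p.1.2 :=
    Finset.sum_congr rfl fun _ _ => mul_comm _ _
  rw [h]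
  ring

lemma sum_yLow_mul_hUp (hF : IsFinslerMetric U F) (p : hF.slit) (j : Fin n) :
    ∑ i, yLow F i p.1.1 p.1.2 * hUp F i j p.1.1 p.1.2 = 0 := by
  have hpos := (hF.pos _ p.2.1 _ p.2.2).ne'
  have h : ∀ i, yLow F i p.1.1 p.1.2 * hUp F i j p.1.1 p.1.2 =
      yLow F i p.1.1 p.1.2 * (if i = j then 1 else 0) - yLow F i p.1.1 p.1.2 * p.1.2 i *
        (yLow F j p.1.1 p.1.2 / F p.1.1 p.1.2 ^ 2) := fun i => by
    rw [hUp]; ring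
  simp only [h, Finset.sum_sub_distrib, ← Finset.sum_mul, hF.sum_yLow_mul p, mul_ite, mul_one,
    mul_zero, Finset.sum_ite_eq', Finset.mem_univ, if_true]
  field_simp
  ring

lemma sum_gInv_mul_gLow (hF : IsFinslerMetric U F) (p : hF.slit) (i l : Fin n) :
    ∑ k, gInv F i k p.1.1 p.1.2 * gLow F k l p.1.1 p.1.2 = if i = l then 1 else 0 := by
  have h : (gMat F p.1.1 p.1.2)⁻¹ * gMat F p.1.1 p.1.2 = 1 :=
    Matrix.nonsing_inv_mul _ (hF.posdef _ p.2.1 _ p.2.2).det_pos.ne'.isUnit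
  have h2 := congrFun (congrFun h i) l
  rwa [Matrix.mul_apply, Matrix.one_apply] at h2

lemma gInv_symm (hF : IsFinslerMetric U F) (p : hF.slit) (i j : Fin n) :
    gInv F i j p.1.1 p.1.2 = gInv F j i p.1.1 p.1.2 := by
  have h : (gMat F p.1.1 p.1.2)⁻¹.transpose = (gMat F p.1.1 p.1.2)⁻¹ := by
    rw [Matrix.transpose_nonsing_inv]
    congr 1
    ext i j
    exact hF.gLow_symm p j i
  exact congrFun (congrFun h j) i

lemma sum_gInv_mul_yLow (hF : IsFinslerMetric U F) (p : hF.slit) (i : Fin n) :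
    ∑ k, gInv F i k p.1.1 p.1.2 * yLow F k p.1.1 p.1.2 = p.1.2 i := by
  simp only [yLow, Finset.mul_sum]
  rw [Finset.sum_comm]
  simp only [← mul_assoc, ← Finset.sum_mul, hF.sum_gInv_mul_gLow p]
  simp

end IsFinslerMetric

namespace IsGIB

open smoothAlgebra

variable {n : ℕ} {U : Set (Pt n)} {F μ lam : Pt n → Pt n → ℝ}

/-- The Landsberg curvature of a generalized isotropic Berwald metric. -/
lemma sum_Bcurv_mul_yLow (hF : IsGIB U F μ lam) (p : hF.finsler.slit) (j k l : Fin n) :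
    ∑ i, Bcurv F i j k l p.1.1 p.1.2 * yLow F i p.1.1 p.1.2 =
      μ p.1.1 p.1.2 * F p.1.1 p.1.2 * Cartan F j k l p.1.1 p.1.2 := by
  have hpos := (hF.finsler.pos _ p.2.1 _ p.2.2).ne'
  have h : ∀ i, Bcurv F i j k l p.1.1 p.1.2 * yLow F i p.1.1 p.1.2 =
      μ p.1.1 p.1.2 * Cartan F j k l p.1.1 p.1.2 / F p.1.1 p.1.2 *
        (yLow F i p.1.1 p.1.2 * p.1.2 i)
      + lam p.1.1 p.1.2 * hLow F k l p.1.1 p.1.2 *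
        (yLow F i p.1.1 p.1.2 * hUp F i j p.1.1 p.1.2)
      + lam p.1.1 p.1.2 * hLow F j l p.1.1 p.1.2 *
        (yLow F i p.1.1 p.1.2 * hUp F i k p.1.1 p.1.2)
      + lam p.1.1 p.1.2 * hLow F j k p.1.1 p.1.2 *
        (yLow F i p.1.1 p.1.2 * hUp F i l p.1.1 p.1.2) := fun i => by
    rw [hF.berwald _ p.2.1 _ p.2.2, ell]
    ring
  simp only [h, Finset.sum_add_distrib, ← Finset.mul_sum, hF.finsler.sum_yLow_mul,
    hF.finsler.sum_yLow_mul_hUp]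
  field_simp
  ring

/-- The Akbar-Zadeh type identity for generalized isotropic Berwald metrics of scalar flag
curvature. -/
lemma cyclic_identity (hF : IsGIB U F μ lam) {K : Pt n → Pt n → ℝ}
    (hK : IsScalarFlagCurv U F K) (p : hF.finsler.slit) (j k l : Fin n) :
    4 * (pdy K j p.1.1 p.1.2 * yLow F k p.1.1 p.1.2 * yLow F l p.1.1 p.1.2
        + pdy K k p.1.1 p.1.2 * yLow F j p.1.1 p.1.2 * yLow F l p.1.1 p.1.2
        + pdy K l p.1.1 p.1.2 * yLow F j p.1.1 p.1.2 * yLow F k p.1.1 p.1.2)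
      - 4 * F p.1.1 p.1.2 ^ 2 * (pdy K j p.1.1 p.1.2 * gLow F k l p.1.1 p.1.2
        + pdy K k p.1.1 p.1.2 * gLow F j l p.1.1 p.1.2
        + pdy K l p.1.1 p.1.2 * gLow F j k p.1.1 p.1.2)
      - 12 * F p.1.1 p.1.2 ^ 2 * K p.1.1 p.1.2 * Cartan F j k l p.1.1 p.1.2 =
    -3 * (2 * F p.1.1 p.1.2 * (∑ s, hD0 F μ s p.1.1 p.1.2 * p.1.2 s)
      - μ p.1.1 p.1.2 ^ 2 * F p.1.1 p.1.2 ^ 2) * Cartan F j k l p.1.1 p.1.2 := by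
  let s := hF.finsler.sprayAlgebra
  let φ := hF.finsler.norm
  let μ' : smoothAlgebra hF.finsler.slit := ofContDiffOn (Function.uncurry μ) hF.smooth_mu
  let K' : smoothAlgebra hF.finsler.slit := ofContDiffOn (Function.uncurry K) hK.1
  have hμ : Represents μ μ' := fun _ => rfl
  have hK' : Represents K K' := fun _ => rfl
  have hφ : Represents F φ := fun _ => rfl
  have hSφ : evalAt p (s.S φ) = 0 := by
    have h : evalAt p (s.S (φ ^ 2)) = 0 := by
      rw [show φ ^ 2 = s.E from rfl, s.S_E, map_zero]
    rw [pow_two, Derivation.leibniz, smul_eq_mul, map_add, map_mul, ← hφ p] at h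
    exact (mul_eq_zero.mp (by linarith :
      F p.1.1 p.1.2 * evalAt p (s.S φ) = 0)).resolve_left (hF.finsler.pos _ p.2.1 _ p.2.2).ne'
  have hB : ∀ j k l, 2 * s.Z j l k s.E = (μ' * φ) * s.Y j (s.Y k (s.Y l s.E)) := by
    intro j k l
    refine ext_evalAt fun q => ?_
    have h : evalAt q (s.Z j l k s.E) =
        2 * ∑ i, Bcurv F i j k l q.1.1 q.1.2 * yLow F i q.1.1 q.1.2 := by
      rw [s.Z_apply, map_sum, Finset.mul_sum]
      refine Finset.sum_congr rfl fun i _ => ?_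
      rw [map_mul, hF.finsler.evalAt_Y_E, ← IsFinslerMetric.represents_Y
        (IsFinslerMetric.represents_Y (IsFinslerMetric.represents_Y
          (hF.finsler.represents_G i) l) k) j q, Bcurv]
      ring
    rw [map_mul, h, map_mul, map_mul, hF.sum_Bcurv_mul_yLow, hF.finsler.evalAt_Y_Y_Y_E,
      ← hμ q, ← hφ q, map_ofNat]
    ring
  have hR : ∀ i k, 2 * s.R i k =
      K' * (2 * s.E * (if i = k then 1 else 0) - s.y i * s.Y k s.E) := by
    intro i k
    refine ext_evalAt fun q => ?_
    have hpos := (hF.finsler.pos _ q.2.1 _ q.2.2).ne'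
    have hδ : evalAt q (if i = k then 1 else 0) = if i = k then 1 else 0 := by
      split_ifs <;> simp
    simp only [map_mul, map_sub, map_ofNat, hδ]
    rw [hF.finsler.evalAt_R, hF.finsler.evalAt_Y_E, hF.finsler.evalAt_y, ← hK' q,
      ← hF.finsler.represents_E q, hK.2 _ q.2.1 _ q.2.2, hUp, F2]
    field_simp
  have h := congrArg (evalAt p) (SprayAlgebra.scalar_flag_identity hB hR j k l)
  simp only [map_mul, map_sub, map_add, map_neg, map_ofNat, Derivation.leibniz, smul_eq_mul] at h
  rw [hSφ] at h
  simp only [s, hF.finsler.evalAt_Y_Y_Y_E, hF.finsler.evalAt_Y_Y_E, hF.finsler.evalAt_Y_E,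
    ← IsFinslerMetric.represents_Y hK' _ p, ← hK' p, ← hμ p, ← hφ p,
    ← hF.finsler.represents_E p, hF.finsler.evalAt_S_eq_sum_hD0 p hμ, F2] at h
  linear_combination h / 4

end IsGIB

/-- The trace of a cyclic identity with respect to a metric `g` with inverse `gi`. -/
lemma trace_cyclic_identity {n : ℕ} (hn : 2 ≤ n) {gi g : Fin n → Fin n → ℝ}
    {K yl y : Fin n → ℝ} {C : Fin n → Fin n → Fin n → ℝ} {E κ t : ℝ}
    (hgi : ∀ i j, gi i j = gi j i) (hg : ∀ i l, ∑ k, gi i k * g k l = if i = l then 1 else 0)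
    (hgiyl : ∀ i, ∑ k, gi i k * yl k = y i) (hyl : ∑ i, yl i * y i = E)
    (hgy : ∀ k, ∑ l, g k l * y l = yl k) (hCy : ∀ j k, ∑ l, C j k l * y l = 0) (hE : E ≠ 0)
    (h : ∀ j k l, 4 * (K j * yl k * yl l + K k * yl j * yl l + K l * yl j * yl k)
      - 4 * E * (K j * g k l + K k * g j l + K l * g j k) - 12 * E * κ * C j k l
      = -3 * t * C j k l) (l : Fin n) :
    4 * E * (n + 1) * K l + 12 * E * κ * ∑ i, ∑ j, gi i j * C i j l =
      3 * t * ∑ i, ∑ j, gi i j * C i j l := by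
  have tr_mul : ∀ a b : Fin n → ℝ,
      ∑ i, ∑ j, gi i j * (a i * b j) = ∑ i, a i * ∑ j, gi i j * b j := by
    intro a b
    simp only [Finset.mul_sum]
    exact Finset.sum_congr rfl fun _ _ => Finset.sum_congr rfl fun _ _ => by ring
  have tr_swap : ∀ f : Fin n → Fin n → ℝ,
      ∑ i, ∑ j, gi i j * f j i = ∑ i, ∑ j, gi i j * f i j := by
    intro f
    rw [Finset.sum_comm]
    exact Finset.sum_congr rfl fun _ _ => Finset.sum_congr rfl fun _ _ => by rw [hgi]
  have tr_g : ∑ i, ∑ j, gi i j * g i j = n := by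
    rw [← tr_swap]
    simp [hg]
  have tr_yl : ∑ i, ∑ j, gi i j * (yl i * yl j) = E := by
    rw [tr_mul]
    simp [hgiyl, hyl]
  have tr_Kyl : ∑ i, ∑ j, gi i j * (K i * yl j) = ∑ i, K i * y i := by
    rw [tr_mul]
    simp [hgiyl]
  have tr_Kg : ∑ i, ∑ j, gi i j * (K i * g j l) = K l := by
    rw [tr_mul K fun j => g j l]
    simp [hg]
  have hKy : ∑ i, K i * y i = 0 := by
    have hjk : ∀ j k, (∑ i, K i * y i) * (yl j * yl k - E * g j k) = 0 := by
      intro j k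
      have h0 : ∑ l, y l * (4 * (K j * yl k * yl l + K k * yl j * yl l + K l * yl j * yl k)
          - 4 * E * (K j * g k l + K k * g j l + K l * g j k) + (3 * t - 12 * E * κ) * C j k l)
          = 0 :=
        Finset.sum_eq_zero fun l _ => by linear_combination y l * h j k l
      have h1 : ∑ l, y l * (4 * (K j * yl k * yl l + K k * yl j * yl l + K l * yl j * yl k)
          - 4 * E * (K j * g k l + K k * g j l + K l * g j k) + (3 * t - 12 * E * κ) * C j k l)
          = 4 * (K j * yl k + K k * yl j) * ∑ l, yl l * y l
            + 4 * (yl j * yl k - E * g j k) * ∑ l, K l * y l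
            - 4 * E * K j * ∑ l, g k l * y l - 4 * E * K k * ∑ l, g j l * y l
            + (3 * t - 12 * E * κ) * ∑ l, C j k l * y l := by
        simp only [Finset.mul_sum, ← Finset.sum_add_distrib, ← Finset.sum_sub_distrib]
        exact Finset.sum_congr rfl fun _ _ => by ring
      rw [h0, hyl, hgy, hgy, hCy] at h1
      linear_combination -h1 / 4
    have h0 : (∑ i, K i * y i) * ∑ j, ∑ k, gi j k * (yl j * yl k)
        - (∑ i, K i * y i) * E * ∑ j, ∑ k, gi j k * g j k = 0 := by
      simp only [Finset.mul_sum, ← Finset.sum_sub_distrib]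
      refine Finset.sum_eq_zero fun j _ => Finset.sum_eq_zero fun k _ => ?_
      linear_combination gi j k * hjk j k
    rw [tr_yl, tr_g] at h0
    have hn' : (2 : ℝ) ≤ n := by exact_mod_cast hn
    have h1 : (∑ i, K i * y i) * (E * (1 - n)) = 0 := by linear_combination h0
    exact (mul_eq_zero.mp h1).resolve_right (mul_ne_zero hE (by linarith))
  have h0 : 4 * yl l * ∑ i, ∑ j, gi i j * (K i * yl j)
      + 4 * yl l * ∑ i, ∑ j, gi i j * (K j * yl i)
      + 4 * K l * ∑ i, ∑ j, gi i j * (yl i * yl j)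
      - 4 * E * ∑ i, ∑ j, gi i j * (K i * g j l) - 4 * E * ∑ i, ∑ j, gi i j * (K j * g i l)
      - 4 * E * K l * ∑ i, ∑ j, gi i j * g i j
      + (3 * t - 12 * E * κ) * ∑ i, ∑ j, gi i j * C i j l = 0 := by
    simp only [Finset.mul_sum, ← Finset.sum_add_distrib, ← Finset.sum_sub_distrib]
    refine Finset.sum_eq_zero fun j _ => Finset.sum_eq_zero fun k _ => ?_
    linear_combination gi j k * h j k l
  rw [tr_swap fun i j => K i * yl j, tr_swap fun i j => K i * g j l, tr_Kyl, hKy, tr_yl, tr_Kg,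
    tr_g] at h0
  linear_combination -h0

/-- **Theorem 4.** On a generalized isotropic Berwald manifold of scalar flag curvature,
`((n+1)/3) K_{y^k} + (K + μ²/4 - μ'/(2F)) I_k = 0`. -/
theorem gib_scalar_flag_curvature_equation {n : ℕ} (U : Set (Pt n))
    (F μ lam K : Pt n → Pt n → ℝ) (hF : IsGIB U F μ lam)
    (hK : IsScalarFlagCurv U F K) :
    ∀ x ∈ U, ∀ y : Pt n, y ≠ 0 → ∀ k : Fin n,
      (((n : ℝ) + 1) / 3) * pdy K k x y +
        (K x y + (μ x y) ^ 2 / 4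
          - (∑ s, hD0 F μ s x y * y s) / (2 * F x y)) * mCartan F k x y = 0 := by
  intro x hx y hy k
  let p : hF.finsler.slit := ⟨(x, y), hx, hy⟩
  have hpos := (hF.finsler.pos x hx y hy).ne'
  have h := trace_cyclic_identity hF.finsler.dim (hF.finsler.gInv_symm p)
    (hF.finsler.sum_gInv_mul_gLow p) (hF.finsler.sum_gInv_mul_yLow p) (hF.finsler.sum_yLow_mul p)
    (fun _ => rfl) (hF.finsler.sum_Cartan_mul p) (pow_ne_zero 2 hpos) (hF.cyclic_identity hK p) k
  change 4 * F x y ^ 2 * (n + 1) * pdy K k x y + 12 * F x y ^ 2 * K x y * mCartan F k x y =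
    3 * (2 * F x y * (∑ s, hD0 F μ s x y * y s) - μ x y ^ 2 * F x y ^ 2) * mCartan F k x y at h
  have hq : ∑ s, hD0 F μ s x y * y s =
      2 * F x y * ((∑ s, hD0 F μ s x y * y s) / (2 * F x y)) := by
    field_simp
  rw [hq] at h
  refine (mul_eq_zero.mp ?_).resolve_left (mul_ne_zero (by norm_num : (12 : ℝ) ≠ 0)
    (pow_ne_zero 2 hpos))
  linear_combination h
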